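/- Fix μ ∈ ℂ with μ ≠ 0, λ ∈ ℂ with Re λ > 0, and a compact set N ⊆ 𝕃_λ. Assume A := limsup_{k→∞} sup_{s∈N} |1/(μ·β_{λ,μ}(s+k))| satisfies A < exp(Re λ). Then there exists K ∈ ℕ such that for every integer k ≥ K the series ∑_{j=1}^∞ sup_{s∈N} |τ^j(s+k) − τ^{j−1}(s+k)| converges; consequently the functions s ↦ τ^n(s+k) converge uniformly on N as n → ∞ to a limit function τ(·+k), and this limit is holomorphic on the interior of N. -/

import Mathlib

open Filter Topology
open scoped ENNReal NNReal

noncomputable section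

/-- Inner composition `q 1 s (q 2 s (… (q n s z)))`, nested in the variable `z`
with the parameter `s` held fixed. -/
def innerComp (q : ℕ → ℂ → ℂ → ℂ) : ℕ → ℂ → ℂ → ℂ
  | 0, _, z => z
  | n + 1, s, z => innerComp q n s (q (n + 1) s z)

/-- The building blocks `q_j(s,z) = exp(μ z)/(1 + exp(λ (j - s)))`. -/
def qfun (lam mu : ℂ) (j : ℕ) (s z : ℂ) : ℂ :=
  Complex.exp (mu * z) / (1 + Complex.exp (lam * ((j : ℂ) - s)))

/-- The set `𝕃_λ = {s : λ(j - s) ≠ (2k+1)πi for all integers j ≥ 1, k}`. -/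
def Lset (lam : ℂ) : Set ℂ :=
  {s : ℂ | ∀ j : ℕ, 1 ≤ j → ∀ k : ℤ,
    lam * ((j : ℂ) - s) ≠ (2 * (k : ℂ) + 1) * (Real.pi : ℂ) * Complex.I}

/-- The function `β_{λ,μ}(s)`, defined as the limit (when it exists) of the inner
compositions `q_1(s, q_2(s, …, q_n(s, 0)))`. -/
def betaF (lam mu : ℂ) (s : ℂ) : ℂ :=
  limUnder atTop (fun n : ℕ => innerComp (qfun lam mu) n s 0)

/-- The τ-process: `τ⁰ = 0`,
`τ^{n+1}(s) = (1/μ)·Log(1 + τ^n(s+1)/β_{λ,μ}(s+1)) − (1/μ)·Log(1 + exp(−λ s))`. -/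
def tauP (lam mu : ℂ) : ℕ → ℂ → ℂ
  | 0, _ => 0
  | n + 1, s =>
      (1 / mu) * Complex.log (1 + tauP lam mu n (s + 1) / betaF lam mu (s + 1)) -
        (1 / mu) * Complex.log (1 + Complex.exp (-(lam * s)))

/-- A function holomorphic near a puncture with real part bounded above is bounded there. -/
lemma eventually_norm_le_of_re_le {g : ℂ → ℂ} {z₀ : ℂ} {C : ℝ}
    (hd : ∀ᶠ z in 𝓝[≠] z₀, DifferentiableAt ℂ g z) (hC : ∀ᶠ z in 𝓝[≠] z₀, (g z).re ≤ C) :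
    ∃ B : ℝ, ∀ᶠ z in 𝓝[≠] z₀, ‖g z‖ ≤ B := by
  obtain ⟨s, hs, hsg⟩ : ∃ s ∈ 𝓝 z₀, ∀ z ∈ s \ {z₀}, DifferentiableAt ℂ g z ∧ (g z).re ≤ C := by
    have h := hd.and hC
    rw [eventually_nhdsWithin_iff] at h
    exact ⟨_, h, fun z hz => hz.1 hz.2⟩
  set w : ℂ → ℂ := fun z => (g z - (C + 1))⁻¹ with hw
  have hre : ∀ z ∈ s \ {z₀}, (g z - (C + 1)).re ≤ -1 := fun z hz => by
    have := (hsg z hz).2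
    simp
    linarith
  have hone : ∀ z ∈ s \ {z₀}, 1 ≤ ‖g z - (C + 1)‖ := fun z hz => by
    have h1 := hre z hz
    have h2 := Complex.abs_re_le_norm (g z - (C + 1))
    have h3 := neg_abs_le (g z - (C + 1)).re
    linarith
  have hne : ∀ z ∈ s \ {z₀}, g z - (C + 1) ≠ 0 := fun z hz h0 => by
    have := hone z hz
    rw [h0, norm_zero] at this
    linarith
  have hwd : DifferentiableOn ℂ w (s \ {z₀}) := fun z hz =>
    (((hsg z hz).1.sub_const _).inv (hne z hz)).differentiableWithinAt
  have hwb : BddAbove (norm ∘ w '' (s \ {z₀})) := by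
    refine ⟨1, ?_⟩
    rintro _ ⟨z, hz, rfl⟩
    simp only [Function.comp, hw, norm_inv]
    exact inv_le_one_of_one_le₀ (hone z hz)
  set W := Function.update w z₀ (limUnder (𝓝[≠] z₀) w)
  have hWd : DifferentiableOn ℂ W s :=
    Complex.differentiableOn_update_limUnder_of_bddAbove hs hwd hwb
  have hWa : AnalyticAt ℂ W z₀ := hWd.analyticAt hs
  have hWw : ∀ z, z ≠ z₀ → W z = w z := fun z hz => Function.update_of_ne hz _ _
  have hs' : ∀ᶠ z in 𝓝[≠] z₀, z ∈ s \ {z₀} := by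
    filter_upwards [self_mem_nhdsWithin, mem_nhdsWithin_of_mem_nhds hs] with z h1 h2
    exact ⟨h2, h1⟩
  by_cases h0 : W z₀ = 0
  · exfalso
    have hWne : ∀ z ∈ s \ {z₀}, W z ≠ 0 := fun z hz => by
      rw [hWw z hz.2]
      exact inv_ne_zero (hne z hz)
    rcases hWa.eventually_constant_or_nhds_le_map_nhds with hc | ho
    · obtain ⟨z, hz1, hz2⟩ := (hs'.and (hc.filter_mono nhdsWithin_le_nhds)).exists
      exact hWne z hz1 (hz2.trans h0)
    · have hmem : W '' s ∈ 𝓝 (0 : ℂ) := h0 ▸ ho (image_mem_map hs)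
      obtain ⟨ε, hε, hb⟩ := Metric.mem_nhds_iff.1 hmem
      obtain ⟨z, hz, hzt⟩ := hb (show ((ε / 2 : ℝ) : ℂ) ∈ Metric.ball 0 ε by
        rw [mem_ball_zero_iff, Complex.norm_real, Real.norm_of_nonneg (by positivity)]
        linarith)
      have hzz : z ≠ z₀ := by
        rintro rfl
        rw [h0] at hzt
        have : ε / 2 = 0 := by exact_mod_cast hzt.symm
        linarith
      have h1 := hre z ⟨hz, hzz⟩
      rw [hWw z hzz] at hzt
      have h2 : g z - (C + 1) = ((ε / 2 : ℝ) : ℂ)⁻¹ := by rw [← hzt, hw, inv_inv]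
      rw [h2, ← Complex.ofReal_inv, Complex.ofReal_re] at h1
      have : 0 < (ε / 2)⁻¹ := by positivity
      linarith
  · have hpos : 0 < ‖W z₀‖ := norm_pos_iff.2 h0
    have hlow : ∀ᶠ z in 𝓝[≠] z₀, ‖W z₀‖ / 2 < ‖W z‖ :=
      (hWa.continuousAt.norm.eventually_const_lt (half_lt_self hpos)).filter_mono
        nhdsWithin_le_nhds
    refine ⟨(‖W z₀‖ / 2)⁻¹ + ‖(C + 1 : ℂ)‖, ?_⟩
    filter_upwards [hlow, hs'] with z hz hzs
    rw [hWw z hzs.2, hw, norm_inv] at hz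
    have h1 : ‖g z - (C + 1)‖ ≤ (‖W z₀‖ / 2)⁻¹ := by
      rw [le_inv_comm₀ (by linarith [hone z hzs]) (by positivity)]
      exact hz.le
    calc ‖g z‖ = ‖(g z - (C + 1)) + (C + 1)‖ := by ring_nf
      _ ≤ _ := (norm_add_le _ _).trans (by gcongr)

lemma norm_log_one_add_sub_le {δ : ℝ} (hδ : δ < 1) {u v : ℂ} (hu : ‖u‖ ≤ δ) (hv : ‖v‖ ≤ δ) :
    ‖Complex.log (1 + u) - Complex.log (1 + v)‖ ≤ ‖u - v‖ / (1 - δ) := by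
  have h := Convex.norm_image_sub_le_of_norm_hasDerivWithin_le
    (f := fun z : ℂ => Complex.log (1 + z)) (f' := fun z => 1 / (1 + z))
    (s := Metric.closedBall 0 δ) (C := 1 / (1 - δ)) (x := v) (y := u) (fun z hz => by
      rw [mem_closedBall_zero_iff] at hz
      exact (((hasDerivAt_id z).const_add 1).clog
        (Complex.mem_slitPlane_of_norm_lt_one (hz.trans_lt hδ))).hasDerivWithinAt)
    (fun z hz => by
      rw [mem_closedBall_zero_iff] at hz
      rw [norm_div, norm_one]
      have := norm_sub_le_norm_add (1 : ℂ) z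
      rw [norm_one] at this
      exact one_div_le_one_div_of_le (by linarith) (by linarith))
    (convex_closedBall _ _) (by simpa using hv) (by simpa using hu)
  rwa [one_div_mul_eq_div] at h

lemma norm_exp_mul_le (mu : ℂ) {z : ℂ} (hz : ‖z‖ ≤ 1) :
    ‖Complex.exp (mu * z)‖ ≤ Real.exp ‖mu‖ := by
  rw [Complex.norm_exp]
  refine Real.exp_le_exp.2 ((Complex.re_le_norm _).trans ?_)
  rw [norm_mul]
  exact mul_le_of_le_one_right (norm_nonneg _) hz

lemma norm_exp_mul_sub_le (mu : ℂ) {z w : ℂ} (hz : ‖z‖ ≤ 1) (hw : ‖w‖ ≤ 1) :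
    ‖Complex.exp (mu * z) - Complex.exp (mu * w)‖ ≤ Real.exp ‖mu‖ * ‖mu‖ * ‖z - w‖ :=
  Convex.norm_image_sub_le_of_norm_hasDerivWithin_le
    (f := fun z : ℂ => Complex.exp (mu * z)) (f' := fun z => Complex.exp (mu * z) * mu)
    (s := Metric.closedBall 0 1) (fun z _ => by
      simpa using (((hasDerivAt_id z).const_mul mu).cexp).hasDerivWithinAt)
    (fun z hz => by
      rw [norm_mul]
      gcongr
      exact norm_exp_mul_le mu (by simpa using hz))
    (convex_closedBall _ _) (by simpa using hw) (by simpa using hz)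

/-- A left half-plane on which every `qfun lam mu j s` maps the unit disc to itself and
halves distances there. -/
def halfPlane (lam mu : ℂ) : Set ℂ :=
  {s | (lam * s).re < -Real.log (1 + 2 * Real.exp ‖mu‖ * (‖mu‖ + 1))}

lemma isOpen_halfPlane (lam mu : ℂ) : IsOpen (halfPlane lam mu) :=
  isOpen_lt (by fun_prop) continuous_const

lemma le_norm_one_add_exp {lam mu s : ℂ} (hlam : 0 < lam.re) (hs : s ∈ halfPlane lam mu)
    (j : ℕ) :
    2 * Real.exp ‖mu‖ * (‖mu‖ + 1) ≤ ‖1 + Complex.exp (lam * ((j : ℂ) - s))‖ := by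
  set D := 2 * Real.exp ‖mu‖ * (‖mu‖ + 1)
  have hD0 : 0 < D := by positivity
  have h1 : 1 + D ≤ ‖Complex.exp (lam * ((j : ℂ) - s))‖ := by
    rw [Complex.norm_exp, ← Real.log_le_iff_le_exp (by positivity), mul_sub, Complex.sub_re]
    have h2 : (lam * (j : ℂ)).re = lam.re * j := by simp
    have h3 : 0 ≤ lam.re * j := by positivity
    have h4 : (lam * s).re < -Real.log (1 + D) := hs
    linarith
  have h5 := norm_sub_le_norm_add (Complex.exp (lam * ((j : ℂ) - s))) 1
  rw [norm_one, add_comm (Complex.exp _)] at h5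
  linarith

lemma one_add_exp_ne_zero_of_mem_halfPlane {lam mu s : ℂ} (hlam : 0 < lam.re)
    (hs : s ∈ halfPlane lam mu) (j : ℕ) : 1 + Complex.exp (lam * ((j : ℂ) - s)) ≠ 0 := by
  rw [← norm_pos_iff]
  exact lt_of_lt_of_le (by positivity) (le_norm_one_add_exp hlam hs j)

lemma norm_qfun_le_one {lam mu s : ℂ} (hlam : 0 < lam.re) (hs : s ∈ halfPlane lam mu)
    (j : ℕ) {z : ℂ} (hz : ‖z‖ ≤ 1) : ‖qfun lam mu j s z‖ ≤ 1 := by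
  have hD := le_norm_one_add_exp hlam hs j
  rw [qfun, norm_div]
  refine div_le_one_of_le₀ ((norm_exp_mul_le mu hz).trans (le_trans ?_ hD)) (norm_nonneg _)
  nlinarith [Real.exp_pos ‖mu‖, mul_nonneg (Real.exp_pos ‖mu‖).le (norm_nonneg mu)]

lemma norm_qfun_sub_le {lam mu s : ℂ} (hlam : 0 < lam.re) (hs : s ∈ halfPlane lam mu)
    (j : ℕ) {z w : ℂ} (hz : ‖z‖ ≤ 1) (hw : ‖w‖ ≤ 1) :
    ‖qfun lam mu j s z - qfun lam mu j s w‖ ≤ 1 / 2 * ‖z - w‖ := by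
  have hD := le_norm_one_add_exp hlam hs j
  have hpos : 0 < 2 * Real.exp ‖mu‖ * (‖mu‖ + 1) := by positivity
  rw [qfun, qfun, ← sub_div, norm_div, div_le_iff₀ (hpos.trans_le hD)]
  calc _ ≤ Real.exp ‖mu‖ * ‖mu‖ * ‖z - w‖ := norm_exp_mul_sub_le mu hz hw
    _ ≤ 1 / 2 * ‖z - w‖ * (2 * Real.exp ‖mu‖ * (‖mu‖ + 1)) := by
      nlinarith [mul_nonneg (Real.exp_pos ‖mu‖).le (norm_nonneg (z - w))]
    _ ≤ _ := by gcongr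

lemma norm_innerComp_sub_le {lam mu s : ℂ} (hlam : 0 < lam.re) (hs : s ∈ halfPlane lam mu)
    (n : ℕ) {z w : ℂ} (hz : ‖z‖ ≤ 1) (hw : ‖w‖ ≤ 1) :
    ‖innerComp (qfun lam mu) n s z - innerComp (qfun lam mu) n s w‖
      ≤ (1 / 2) ^ n * ‖z - w‖ := by
  induction n generalizing z w with
  | zero => simp [innerComp]
  | succ n ih =>
    refine (ih (norm_qfun_le_one hlam hs _ hz) (norm_qfun_le_one hlam hs _ hw)).trans ?_
    rw [pow_succ, mul_assoc]
    gcongr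
    exact norm_qfun_sub_le hlam hs _ hz hw

lemma differentiableOn_innerComp {lam mu : ℂ} (hlam : 0 < lam.re) (n : ℕ) {h : ℂ → ℂ}
    (hh : DifferentiableOn ℂ h (halfPlane lam mu)) :
    DifferentiableOn ℂ (fun s => innerComp (qfun lam mu) n s (h s)) (halfPlane lam mu) := by
  induction n generalizing h with
  | zero => exact hh
  | succ n ih =>
    refine ih (DifferentiableOn.div (by fun_prop) (by fun_prop) fun s hs => ?_)
    exact one_add_exp_ne_zero_of_mem_halfPlane hlam hs _

lemma tendstoUniformlyOn_of_summable_dist {F : ℕ → ℂ → ℂ} {u : ℕ → ℝ} {s : Set ℂ}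
    (hF : F 0 = 0) (hu : Summable u) (h : ∀ n, ∀ x ∈ s, ‖F (n + 1) x - F n x‖ ≤ u n) :
    TendstoUniformlyOn F (fun x => ∑' n, (F (n + 1) x - F n x)) atTop s := by
  refine (tendstoUniformlyOn_tsum_nat hu h).congr (Eventually.of_forall fun n x _ => ?_)
  simp only
  rw [Finset.sum_range_sub (fun n => F n x), hF, Pi.zero_apply, sub_zero]

lemma exists_tendstoUniformlyOn_innerComp {lam mu : ℂ} (hlam : 0 < lam.re) :
    ∃ T : ℂ → ℂ, TendstoUniformlyOn (fun n s => innerComp (qfun lam mu) n s 0) T atTop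
      (halfPlane lam mu) := by
  refine ⟨_, tendstoUniformlyOn_of_summable_dist rfl summable_geometric_two fun n s hs => ?_⟩
  have hq := norm_qfun_le_one hlam hs (n + 1) (z := 0) (by simp)
  refine (norm_innerComp_sub_le hlam hs n hq (by simp)).trans ?_
  rw [sub_zero]
  exact mul_le_of_le_one_right (by positivity) hq

lemma qfun_add_one (lam mu : ℂ) (j : ℕ) (s z : ℂ) :
    qfun lam mu (j + 1) (s + 1) z = qfun lam mu j s z := by
  rw [qfun, qfun]
  congr 4
  push_cast
  ring

lemma innerComp_qfun_add_one (lam mu : ℂ) (n : ℕ) (s z : ℂ) :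
    innerComp (qfun lam mu) (n + 1) (s + 1) z =
      qfun lam mu 0 s (innerComp (qfun lam mu) n s z) := by
  induction n generalizing z with
  | zero => exact qfun_add_one lam mu 0 s z
  | succ n ih =>
    rw [innerComp, ih, qfun_add_one]
    rfl

lemma exists_nat_sub_mem_halfPlane {lam : ℂ} (mu : ℂ) (hlam : 0 < lam.re) (s : ℂ) :
    ∃ J : ℕ, s - J ∈ halfPlane lam mu := by
  set R := Real.log (1 + 2 * Real.exp ‖mu‖ * (‖mu‖ + 1))
  obtain ⟨J, hJ⟩ := exists_nat_gt (((lam * s).re + R) / lam.re)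
  refine ⟨J, ?_⟩
  rw [div_lt_iff₀ hlam] at hJ
  have : (lam * (J : ℂ)).re = lam.re * J := by simp
  change (lam * (s - J)).re < -R
  rw [mul_sub, Complex.sub_re]
  linarith

/-- Induction along `s ↦ s + 1`, starting from `halfPlane lam mu`. -/
lemma halfPlane_induction {lam : ℂ} (mu : ℂ) (hlam : 0 < lam.re) {P : ℂ → Prop}
    (base : ∀ s ∈ halfPlane lam mu, P s) (step : ∀ s, P s → P (s + 1)) (s : ℂ) : P s := by
  obtain ⟨J, hJ⟩ := exists_nat_sub_mem_halfPlane mu hlam s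
  have : ∀ n : ℕ, P (s - J + n) := fun n => by
    induction n with
    | zero => simpa using base _ hJ
    | succ n ih =>
      have := step _ ih
      push_cast
      rwa [← add_assoc]
  simpa using this J

lemma tendsto_innerComp_betaF {lam : ℂ} (mu : ℂ) (hlam : 0 < lam.re) (s : ℂ) :
    Tendsto (fun n => innerComp (qfun lam mu) n s 0) atTop (𝓝 (betaF lam mu s)) := by
  refine tendsto_nhds_limUnder (halfPlane_induction mu hlam
    (P := fun s => ∃ b, Tendsto (fun n => innerComp (qfun lam mu) n s 0) atTop (𝓝 b))
    (fun s hs => ?_) ?_ s)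
  · obtain ⟨T, hT⟩ := exists_tendstoUniformlyOn_innerComp (mu := mu) hlam
    exact ⟨_, hT.tendsto_at hs⟩
  · rintro s ⟨b, hb⟩
    refine ⟨qfun lam mu 0 s b, (tendsto_add_atTop_iff_nat 1).1 ?_⟩
    simp only [innerComp_qfun_add_one, qfun]
    exact ((Complex.continuous_exp.tendsto _).comp (hb.const_mul mu)).div_const _

lemma betaF_add_one {lam : ℂ} (mu : ℂ) (hlam : 0 < lam.re) (s : ℂ) :
    betaF lam mu (s + 1) =
      Complex.exp (mu * betaF lam mu s) / (1 + Complex.exp (-(lam * s))) := by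
  have h := (tendsto_add_atTop_iff_nat 1).2 (tendsto_innerComp_betaF mu hlam (s + 1))
  refine tendsto_nhds_unique h ?_
  simp only [innerComp_qfun_add_one, qfun]
  convert ((Complex.continuous_exp.tendsto _).comp
    ((tendsto_innerComp_betaF mu hlam s).const_mul mu)).div_const _ using 4 <;> simp

lemma one_add_exp_ne_zero_of_mem_Lset {lam s : ℂ} (hs : s ∈ Lset lam) {j : ℕ} (hj : 1 ≤ j) :
    1 + Complex.exp (lam * ((j : ℂ) - s)) ≠ 0 := by
  intro h
  have h1 : Complex.exp (lam * ((j : ℂ) - s)) = Complex.exp (Real.pi * Complex.I) := by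
    rw [Complex.exp_pi_mul_I]
    linear_combination h
  obtain ⟨k, hk⟩ := Complex.exp_eq_exp_iff_exists_int.1 h1
  exact hs j hj k (by rw [hk]; ring)

lemma mem_Lset_iff {lam s : ℂ} :
    s ∈ Lset lam ↔ ∀ j : ℕ, 1 ≤ j → 1 + Complex.exp (lam * ((j : ℂ) - s)) ≠ 0 := by
  refine ⟨fun h j hj => one_add_exp_ne_zero_of_mem_Lset h hj, fun h j hj k hk => h j hj ?_⟩
  have h1 : Complex.exp (lam * ((j : ℂ) - s)) = Complex.exp (Real.pi * Complex.I) :=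
    Complex.exp_eq_exp_iff_exists_int.2 ⟨k, by rw [hk]; ring⟩
  rw [h1, Complex.exp_pi_mul_I]
  ring

lemma add_one_mem_Lset_iff {lam s : ℂ} :
    s + 1 ∈ Lset lam ↔ s ∈ Lset lam ∧ 1 + Complex.exp (-(lam * s)) ≠ 0 := by
  simp only [mem_Lset_iff]
  have key : ∀ j : ℕ, lam * (((j + 1 : ℕ) : ℂ) - (s + 1)) = lam * ((j : ℂ) - s) := fun j => by
    push_cast
    ring
  constructor
  · refine fun h => ⟨fun j _ => key j ▸ h (j + 1) (by omega), ?_⟩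
    have h0 := h (0 + 1) le_rfl
    rw [key 0] at h0
    simpa using h0
  · rintro ⟨h, h0⟩ (_ | _ | j) hj
    · omega
    · rw [key 0]
      simpa using h0
    · rw [key]
      exact h _ (by omega)

lemma differentiableAt_betaF {lam mu : ℂ} (hlam : 0 < lam.re) (s : ℂ) :
    s ∈ Lset lam → DifferentiableAt ℂ (betaF lam mu) s := by
  refine halfPlane_induction mu hlam (P := fun s => s ∈ Lset lam → DifferentiableAt ℂ _ s)
    (fun s hs _ => ?_) (fun s ih hs => ?_) s
  · obtain ⟨T, hT⟩ := exists_tendstoUniformlyOn_innerComp (mu := mu) hlam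
    have hT' : Set.EqOn (betaF lam mu) T (halfPlane lam mu) := fun s hs =>
      tendsto_nhds_unique (tendsto_innerComp_betaF mu hlam s) (hT.tendsto_at hs)
    have hd := hT.tendstoLocallyUniformlyOn.differentiableOn
      (Eventually.of_forall fun n => differentiableOn_innerComp hlam n
        (differentiableOn_const 0)) (isOpen_halfPlane lam mu)
    exact (hd.congr hT').differentiableAt ((isOpen_halfPlane lam mu).mem_nhds hs)
  · obtain ⟨hs1, hs2⟩ := add_one_mem_Lset_iff.1 hs
    have hβ : betaF lam mu = fun s => Complex.exp (mu * betaF lam mu (s - 1)) /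
        (1 + Complex.exp (-(lam * (s - 1)))) := by
      funext s
      rw [← betaF_add_one mu hlam, sub_add_cancel]
    have h1 : DifferentiableAt ℂ (fun s => betaF lam mu (s - 1)) (s + 1) := by
      have : DifferentiableAt ℂ (betaF lam mu) (s + 1 - 1) := by simpa using ih hs1
      exact DifferentiableAt.comp (g := betaF lam mu) (s + 1) this (differentiableAt_id.sub_const 1)
    rw [hβ]
    exact (h1.const_mul mu).cexp.div (by fun_prop) (by simpa using hs2)

lemma betaF_ne_zero {lam mu s : ℂ} (hlam : 0 < lam.re) (hs : s ∈ Lset lam) :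
    betaF lam mu s ≠ 0 := by
  rw [← sub_add_cancel s 1] at hs ⊢
  rw [betaF_add_one mu hlam]
  exact div_ne_zero (Complex.exp_ne_zero _) (add_one_mem_Lset_iff.1 hs).2

lemma re_eq_zero_of_one_add_exp_neg_eq_zero {w : ℂ} (h : 1 + Complex.exp (-w) = 0) :
    w.re = 0 := by
  have h1 : ‖Complex.exp (-w)‖ = 1 := by
    rw [show Complex.exp (-w) = -1 by linear_combination h, norm_neg, norm_one]
  rw [Complex.norm_exp, Real.exp_eq_one_iff, Complex.neg_re] at h1
  linarith

lemma eventually_add_natCast_mem_Lset {lam s₀ : ℂ} (hlam : 0 < lam.re) {m : ℕ}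
    (hbad : 1 + Complex.exp (-(lam * (s₀ + m))) = 0) (hL : ∀ᶠ s in 𝓝 s₀, s ∈ Lset lam) :
    ∀ᶠ s : ℂ in 𝓝[≠] s₀, ∀ k : ℕ, s + (k : ℂ) ∈ Lset lam := by
  have hm := re_eq_zero_of_one_add_exp_neg_eq_zero hbad
  have hnear : ∀ᶠ s in 𝓝 s₀, |(lam * (s - s₀)).re| < lam.re := by
    have hc : Continuous fun s => |(lam * (s - s₀)).re| := by fun_prop
    exact hc.continuousAt.eventually_lt_const (by simpa using hlam)
  have hder : HasDerivAt (fun s => 1 + Complex.exp (-(lam * (s + m))))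
      (Complex.exp (-(lam * (s₀ + m))) * -(lam * 1)) s₀ :=
    (((((hasDerivAt_id s₀).add_const (m : ℂ)).const_mul lam).neg).cexp).const_add 1
  have hlam0 : lam ≠ 0 := by
    rintro rfl
    simp at hlam
  have hne := hder.eventually_ne (c := 0)
    (mul_ne_zero (Complex.exp_ne_zero _) (by simpa using hlam0))
  filter_upwards [hne, nhdsWithin_le_nhds hnear, nhdsWithin_le_nhds hL] with s h1 h2 h3 k
  induction k with
  | zero => simpa using h3
  | succ k ih =>
    rw [Nat.cast_succ, ← add_assoc, add_one_mem_Lset_iff]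
    refine ⟨ih, fun h => ?_⟩
    by_cases hk : k = m
    · exact h1 (hk ▸ h)
    · have h4 := re_eq_zero_of_one_add_exp_neg_eq_zero h
      have h5 : (lam * (s - s₀)).re = ((m - k : ℤ) : ℝ) * lam.re := by
        have : lam * (s - s₀) = lam * (s + k) - lam * (s₀ + m) + ((m - k : ℤ) : ℝ) * lam := by
          push_cast
          ring
        rw [this, Complex.add_re, Complex.sub_re, hm, h4, Complex.re_ofReal_mul]
        ring
      rw [h5, abs_mul, abs_of_pos hlam] at h2
      have h6 : (1 : ℝ) ≤ |((m - k : ℤ) : ℝ)| := by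
        exact_mod_cast Int.one_le_abs (by omega : (m - k : ℤ) ≠ 0)
      nlinarith

lemma betaF_add_natCast_succ {lam : ℂ} (mu : ℂ) (hlam : 0 < lam.re) (s : ℂ) (k : ℕ) :
    betaF lam mu (s + (k + 1 : ℕ)) =
      Complex.exp (mu * betaF lam mu (s + k)) / (1 + Complex.exp (-(lam * (s + k)))) := by
  rw [Nat.cast_succ, ← add_assoc, betaF_add_one mu hlam]

lemma differentiableAt_betaF_add {lam mu s c : ℂ} (hlam : 0 < lam.re) (hs : s + c ∈ Lset lam) :
    DifferentiableAt ℂ (fun s => betaF lam mu (s + c)) s :=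
  DifferentiableAt.comp (g := betaF lam mu) s (differentiableAt_betaF hlam _ hs)
    (differentiableAt_id.add_const c)

/-- A lower bound on the shifts of `betaF` near `s₀` rules out that some shift has a
singularity at `s₀`: the first singularity would be a pole, the later ones essential. -/
lemma add_natCast_mem_Lset {lam mu s₀ : ℂ} (hmu : mu ≠ 0) (hlam : 0 < lam.re)
    (hL : ∀ᶠ s in 𝓝 s₀, s ∈ Lset lam) {a : ℝ} {K : ℕ}
    (ha : ∀ k, K ≤ k → ∀ᶠ s in 𝓝 s₀, ‖1 / (mu * betaF lam mu (s + (k : ℂ)))‖ ≤ a) (k : ℕ) :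
    s₀ + k ∈ Lset lam := by
  by_contra hk
  obtain ⟨m, hm, hm'⟩ : ∃ m : ℕ, s₀ + m ∈ Lset lam ∧ s₀ + (m + 1 : ℕ) ∉ Lset lam := by
    by_contra! h
    refine hk ?_
    clear hk
    induction k with
    | zero => simpa using hL.self_of_nhds
    | succ k ih => exact h k ih
  rw [Nat.cast_succ, ← add_assoc, add_one_mem_Lset_iff, not_and, not_not] at hm'
  have hbad := hm' hm
  have hre := re_eq_zero_of_one_add_exp_neg_eq_zero hbad
  have hG := eventually_add_natCast_mem_Lset hlam hbad hL
  have hcont : ∀ j : ℕ, Continuous fun s => 1 + Complex.exp (-(lam * (s + j))) := fun j => by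
    fun_prop
  have hden : ∀ᶠ s in 𝓝[≠] s₀, ∀ j : ℕ, 1 + Complex.exp (-(lam * (s + j))) ≠ 0 := by
    filter_upwards [hG] with s hs j
    have := hs (j + 1)
    rw [Nat.cast_succ, ← add_assoc, add_one_mem_Lset_iff] at this
    exact this.2
  have hbdd : ∀ (c : ℂ) (j : ℕ), c ≠ 0 →
      (∃ B : ℝ, ∀ᶠ s in 𝓝[≠] s₀, ‖Complex.exp (c * betaF lam mu (s + j))‖ ≤ B) →
      ∃ B : ℝ, ∀ᶠ s in 𝓝[≠] s₀, ‖betaF lam mu (s + j)‖ ≤ B := by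
    rintro c j hc ⟨B, hB⟩
    obtain ⟨B', hB'⟩ := eventually_norm_le_of_re_le (C := Real.log B)
      (g := fun s => c * betaF lam mu (s + j)) (z₀ := s₀)
      (by
        filter_upwards [hG] with s hs
        exact (differentiableAt_betaF_add hlam (hs j)).const_mul c)
      (by
        filter_upwards [hB] with s hs
        rw [Complex.norm_exp] at hs
        exact (Real.le_log_iff_exp_le ((Real.exp_pos _).trans_le hs)).2 hs)
    refine ⟨B' / ‖c‖, ?_⟩
    filter_upwards [hB'] with s hs
    rw [norm_mul] at hs
    rw [le_div_iff₀ (norm_pos_iff.2 hc)]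
    linarith
  obtain ⟨n, hn⟩ : ∃ n, n = m + 1 + K := ⟨_, rfl⟩
  have htop : ∃ B : ℝ, ∀ᶠ s in 𝓝[≠] s₀, ‖betaF lam mu (s + n)‖ ≤ B := by
    refine hbdd (-mu) _ (neg_ne_zero.2 hmu) ?_
    have h0 : 1 + Complex.exp (-(lam * (s₀ + n))) ≠ 0 := fun h => by
      have h1 := re_eq_zero_of_one_add_exp_neg_eq_zero h
      have h2 : lam * (s₀ + n) = lam * (s₀ + m) + ((K + 1 : ℕ) : ℝ) * lam := by
        rw [hn]
        push_cast
        ring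
      rw [h2, Complex.add_re, hre, Complex.re_ofReal_mul, zero_add] at h1
      have : 0 < ((K + 1 : ℕ) : ℝ) * lam.re := by positivity
      linarith
    have hlow := ((hcont n).norm.continuousAt (x := s₀)).eventually_const_lt
      (half_lt_self (norm_pos_iff.2 h0))
    set d := ‖1 + Complex.exp (-(lam * (s₀ + n)))‖ / 2
    have hd0 : 0 < d := half_pos (norm_pos_iff.2 h0)
    refine ⟨‖mu‖ * a / d, ?_⟩
    filter_upwards [nhdsWithin_le_nhds hlow, nhdsWithin_le_nhds (ha (n + 1) (by omega)), hden]
      with s h1 h2 h3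
    have h4 : Complex.exp (-mu * betaF lam mu (s + n)) = mu *
        (1 / (mu * betaF lam mu (s + (n + 1 : ℕ)))) / (1 + Complex.exp (-(lam * (s + n)))) := by
      rw [betaF_add_natCast_succ mu hlam, neg_mul, Complex.exp_neg]
      generalize betaF lam mu (s + n) = b
      have hd' := h3 n
      generalize 1 + Complex.exp (-(lam * (s + n))) = d' at hd'
      have hb := Complex.exp_ne_zero (mu * b)
      generalize Complex.exp (mu * b) = e at hb
      field_simp
    rw [h4, norm_div, norm_mul]
    have := (norm_nonneg _).trans h2
    gcongr
  have hdown : ∀ j : ℕ, (∃ B : ℝ, ∀ᶠ s in 𝓝[≠] s₀, ‖betaF lam mu (s + (j + 1 : ℕ))‖ ≤ B) →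
      ∃ B : ℝ, ∀ᶠ s in 𝓝[≠] s₀, ‖betaF lam mu (s + j)‖ ≤ B := by
    rintro j ⟨B, hB⟩
    refine hbdd mu j hmu ⟨B * (‖1 + Complex.exp (-(lam * (s₀ + j)))‖ + 1), ?_⟩
    have hup := ((hcont j).norm.continuousAt (x := s₀)).eventually_lt_const
      (lt_add_one _)
    filter_upwards [nhdsWithin_le_nhds hup, hB, hden] with s h1 h2 h3
    have h4 : Complex.exp (mu * betaF lam mu (s + j)) = betaF lam mu (s + (j + 1 : ℕ)) *
        (1 + Complex.exp (-(lam * (s + j)))) := by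
      rw [betaF_add_natCast_succ mu hlam, div_mul_cancel₀ _ (h3 j)]
    rw [h4, norm_mul]
    have := (norm_nonneg _).trans h2
    gcongr
  obtain ⟨B, hB⟩ : ∃ B : ℝ, ∀ᶠ s in 𝓝[≠] s₀, ‖betaF lam mu (s + (m + 1 : ℕ))‖ ≤ B := by
    have : ∀ i j : ℕ, (∃ B : ℝ, ∀ᶠ s in 𝓝[≠] s₀, ‖betaF lam mu (s + (j + i : ℕ))‖ ≤ B) →
        ∃ B : ℝ, ∀ᶠ s in 𝓝[≠] s₀, ‖betaF lam mu (s + j)‖ ≤ B := fun i => by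
      induction i with
      | zero => exact fun j h => h
      | succ i ih => exact fun j h => ih j (hdown _ h)
    exact this K (m + 1) (hn ▸ htop)
  have hlim0 : Tendsto (fun s => betaF lam mu (s + (m + 1 : ℕ)) *
      (1 + Complex.exp (-(lam * (s + m))))) (𝓝[≠] s₀) (𝓝 0) := by
    refine Filter.isBoundedUnder_le_mul_tendsto_zero ⟨B, hB⟩ ?_
    have := (hcont m).tendsto s₀
    rw [hbad] at this
    exact this.mono_left nhdsWithin_le_nhds
  have hlim1 : Tendsto (fun s => Complex.exp (mu * betaF lam mu (s + m))) (𝓝[≠] s₀)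
      (𝓝 (Complex.exp (mu * betaF lam mu (s₀ + m)))) :=
    ((differentiableAt_betaF_add hlam hm).const_mul mu).cexp.continuousAt.tendsto.mono_left
      nhdsWithin_le_nhds
  refine Complex.exp_ne_zero _ (tendsto_nhds_unique hlim1 (hlim0.congr' ?_))
  filter_upwards [hden] with s hs
  rw [betaF_add_natCast_succ mu hlam, div_mul_cancel₀ _ (hs m)]

/-- One contraction step of the `τ`-process. -/
lemma norm_log_div_sub_le {mu b u v : ℂ} (hmu : mu ≠ 0) {a δ M : ℝ} (hδ : δ < 1)
    (ha : ‖1 / (mu * b)‖ ≤ a) (hM : ‖mu‖ * a * M ≤ δ) (hu : ‖u‖ ≤ M) (hv : ‖v‖ ≤ M) :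
    ‖u / b‖ ≤ δ ∧ ‖1 / mu * Complex.log (1 + u / b) - 1 / mu * Complex.log (1 + v / b)‖
      ≤ a / (1 - δ) * ‖u - v‖ := by
  have ha0 : 0 ≤ a := (norm_nonneg _).trans ha
  have hmu0 : 0 < ‖mu‖ := norm_pos_iff.2 hmu
  have hdiv : ∀ x : ℂ, ‖x / b‖ ≤ ‖mu‖ * a * ‖x‖ := fun x => by
    have h1 : x / b = mu * (1 / (mu * b)) * x := by
      rw [one_div, mul_inv, mul_inv_cancel_left₀ hmu, div_eq_inv_mul]
    rw [h1, norm_mul, norm_mul]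
    gcongr
  have hle : ∀ x : ℂ, ‖x‖ ≤ M → ‖x / b‖ ≤ δ := fun x hx =>
    (hdiv x).trans (le_trans (by gcongr) hM)
  refine ⟨hle u hu, ?_⟩
  have h1δ : 0 < 1 - δ := by linarith
  rw [← mul_sub, norm_mul, norm_div, norm_one]
  calc 1 / ‖mu‖ * ‖Complex.log (1 + u / b) - Complex.log (1 + v / b)‖
      ≤ 1 / ‖mu‖ * ((‖mu‖ * a * ‖u - v‖) / (1 - δ)) := by
        gcongr
        refine (norm_log_one_add_sub_le hδ (hle u hu) (hle v hv)).trans ?_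
        rw [← sub_div]
        gcongr
        exact hdiv _
    _ = a / (1 - δ) * ‖u - v‖ := by
        field_simp

lemma exists_norm_log_one_add_exp_le {lam : ℂ} (mu : ℂ) (hlam : 0 < lam.re) {N : Set ℂ}
    (hN : IsCompact N) : ∃ C : ℝ, 0 ≤ C ∧ ∀ᶠ k : ℕ in atTop, ∀ s ∈ N,
      ‖Complex.exp (-(lam * (s + k)))‖ < 1 ∧
      ‖1 / mu * Complex.log (1 + Complex.exp (-(lam * (s + k))))‖
        ≤ C * Real.exp (-lam.re) ^ k := by
  obtain ⟨D, hD⟩ := hN.exists_bound_of_continuousOn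
    (f := fun s => Complex.exp (-(lam * s))) (by fun_prop)
  have hr : Real.exp (-lam.re) < 1 := Real.exp_lt_one_iff.2 (by linarith)
  have hlim : Tendsto (fun k : ℕ => |D| * Real.exp (-lam.re) ^ k) atTop (𝓝 0) := by
    simpa using (tendsto_pow_atTop_nhds_zero_of_lt_one (Real.exp_pos _).le hr).const_mul |D|
  refine ⟨‖1 / mu‖ * (3 / 2 * |D|), by positivity, ?_⟩
  filter_upwards [hlim.eventually_le_const (show (0 : ℝ) < 1 / 2 by norm_num)] with k hk s hs
  have h1 : ‖Complex.exp (-(lam * (s + k)))‖ ≤ |D| * Real.exp (-lam.re) ^ k := by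
    have h2 : -(lam * (s + k)) = -(lam * s) + k * -lam := by ring
    rw [h2, Complex.exp_add, Complex.exp_nat_mul, norm_mul, norm_pow, Complex.norm_exp (-lam),
      Complex.neg_re]
    gcongr
    exact (hD s hs).trans (le_abs_self D)
  refine ⟨by linarith, ?_⟩
  rw [norm_mul, mul_assoc, mul_assoc]
  gcongr
  refine (Complex.norm_log_one_add_half_le_self (h1.trans hk)).trans ?_
  gcongr

lemma tauP_succ_add_natCast (lam mu : ℂ) (n k : ℕ) (s : ℂ) :
    tauP lam mu (n + 1) (s + k) =
      1 / mu * Complex.log (1 + tauP lam mu n (s + (k + 1 : ℕ)) /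
        betaF lam mu (s + (k + 1 : ℕ))) -
        1 / mu * Complex.log (1 + Complex.exp (-(lam * (s + k)))) := by
  rw [tauP, Nat.cast_succ, add_assoc]

section Contraction

variable {lam mu : ℂ} {N : Set ℂ} {a δ q r C : ℝ} {K : ℕ}

lemma norm_tauP_le (hmu : mu ≠ 0) (hr0 : 0 < r) (hC : 0 ≤ C) (hq1 : q < 1)
    (hδ : δ < 1) (hq : a / (1 - δ) * r = q)
    (ha : ∀ k, K ≤ k → ∀ s ∈ N, ‖1 / (mu * betaF lam mu (s + (k : ℂ)))‖ ≤ a)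
    (hlog : ∀ k : ℕ, K ≤ k → ∀ s ∈ N,
      ‖1 / mu * Complex.log (1 + Complex.exp (-(lam * (s + k))))‖ ≤ C * r ^ k)
    (hsmall : ∀ k, K ≤ k → ‖mu‖ * a * (C / (1 - q) * r ^ k) ≤ δ)
    (n k : ℕ) (hk : K ≤ k) (s : ℂ) (hs : s ∈ N) :
    ‖tauP lam mu n (s + k)‖ ≤ C / (1 - q) * r ^ k := by
  have h1q : 0 < 1 - q := by linarith
  induction n generalizing k with
  | zero =>
    rw [tauP, norm_zero]
    positivity
  | succ n ih =>
    have h0 := ih (k + 1) (by omega)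
    have h1 := (norm_log_div_sub_le hmu hδ (ha (k + 1) (by omega) s hs)
      (hsmall (k + 1) (by omega)) h0 (v := 0) (by rw [norm_zero]; positivity)).2
    rw [zero_div, add_zero, Complex.log_one, mul_zero, sub_zero, sub_zero] at h1
    have ha0 : 0 ≤ a := (norm_nonneg _).trans (ha k hk s hs)
    have h1δ : 0 < 1 - δ := by linarith
    rw [tauP_succ_add_natCast]
    calc _ ≤ a / (1 - δ) * (C / (1 - q) * r ^ (k + 1)) + C * r ^ k :=
          (norm_sub_le _ _).trans (add_le_add (h1.trans (by gcongr)) (hlog k hk s hs))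
      _ = (a / (1 - δ) * r * (C / (1 - q)) + C) * r ^ k := by ring
      _ = C / (1 - q) * r ^ k := by
          rw [hq]
          congr 1
          field_simp
          ring

lemma norm_tauP_succ_sub_le (hmu : mu ≠ 0) (hr0 : 0 < r) (hC : 0 ≤ C)
    (hq1 : q < 1) (hδ : δ < 1) (hq : a / (1 - δ) * r = q)
    (ha : ∀ k, K ≤ k → ∀ s ∈ N, ‖1 / (mu * betaF lam mu (s + (k : ℂ)))‖ ≤ a)
    (hlog : ∀ k : ℕ, K ≤ k → ∀ s ∈ N,
      ‖1 / mu * Complex.log (1 + Complex.exp (-(lam * (s + k))))‖ ≤ C * r ^ k)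
    (hsmall : ∀ k, K ≤ k → ‖mu‖ * a * (C / (1 - q) * r ^ k) ≤ δ)
    (n k : ℕ) (hk : K ≤ k) (s : ℂ) (hs : s ∈ N) :
    ‖tauP lam mu (n + 1) (s + k) - tauP lam mu n (s + k)‖ ≤ C * r ^ k * q ^ n := by
  induction n generalizing k with
  | zero =>
    rw [tauP_succ_add_natCast]
    simpa [tauP] using hlog k hk s hs
  | succ n ih =>
    have hle := fun n => norm_tauP_le hmu hr0 hC hq1 hδ hq ha hlog hsmall n (k + 1)
      (by omega) s hs
    have h1 := (norm_log_div_sub_le hmu hδ (ha (k + 1) (by omega) s hs)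
      (hsmall (k + 1) (by omega)) (hle (n + 1)) (hle n)).2
    have ha0 : 0 ≤ a := (norm_nonneg _).trans (ha k hk s hs)
    have h1δ : 0 < 1 - δ := by linarith
    rw [tauP_succ_add_natCast _ _ (n + 1), tauP_succ_add_natCast _ _ n k, sub_sub_sub_cancel_right]
    calc _ ≤ a / (1 - δ) * (C * r ^ (k + 1) * q ^ n) :=
          h1.trans (by gcongr; exact ih (k + 1) (by omega))
      _ = C * r ^ k * (a / (1 - δ) * r * q ^ n) := by ring
      _ = C * r ^ k * q ^ (n + 1) := by rw [hq, pow_succ']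

lemma differentiableOn_tauP (hmu : mu ≠ 0) (hlam : 0 < lam.re) (hδ : δ < 1) {M : ℕ → ℝ}
    {U : Set ℂ} (hUL : ∀ k : ℕ, ∀ s ∈ U, s + k ∈ Lset lam)
    (ha : ∀ k, K ≤ k → ∀ s ∈ U, ‖1 / (mu * betaF lam mu (s + (k : ℂ)))‖ ≤ a)
    (hexp : ∀ k : ℕ, K ≤ k → ∀ s ∈ U, ‖Complex.exp (-(lam * (s + k)))‖ < 1)
    (hsmall : ∀ k, K ≤ k → ‖mu‖ * a * M k ≤ δ)
    (htau : ∀ n k : ℕ, K ≤ k → ∀ s ∈ U, ‖tauP lam mu n (s + k)‖ ≤ M k)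
    (n k : ℕ) (hk : K ≤ k) :
    DifferentiableOn ℂ (fun s => tauP lam mu n (s + k)) U := by
  induction n generalizing k with
  | zero => exact differentiableOn_const 0
  | succ n ih =>
    simp only [tauP_succ_add_natCast]
    have hβ : DifferentiableOn ℂ (fun s => betaF lam mu (s + (k + 1 : ℕ))) U := fun s hs =>
      (differentiableAt_betaF_add hlam (hUL _ s hs)).differentiableWithinAt
    have hdiv := (ih (k + 1) (by omega)).fun_div hβ fun s hs => betaF_ne_zero hlam (hUL _ s hs)
    refine (((hdiv.const_add 1).clog fun s hs => ?_).const_mul _).fun_sub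
      ((DifferentiableOn.clog (by fun_prop) fun s hs => ?_).const_mul _)
    · have hτ := htau n (k + 1) (by omega) s hs
      exact Complex.mem_slitPlane_of_norm_lt_one ((norm_log_div_sub_le hmu hδ
        (ha (k + 1) (by omega) s hs) (hsmall (k + 1) (by omega)) hτ hτ).1.trans_lt hδ)
    · exact Complex.mem_slitPlane_of_norm_lt_one (hexp k hk s hs)

end Contraction

/-- **The Convergence Theorem.** If
`A = limsup_k sup_{s∈N} |1/(μ·β_{λ,μ}(s+k))| < exp(Re λ)`, then there is `K` such that for
every `k ≥ K` the series `∑_j sup_{s∈N} |τ^j(s+k) − τ^{j−1}(s+k)|` converges; hence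
`τ^n(·+k)` converges uniformly on `N` to a limit holomorphic on the interior of `N`. -/
theorem convergence_theorem (lam mu : ℂ) (hmu : mu ≠ 0) (hlam : 0 < lam.re)
    (N : Set ℂ) (hNc : IsCompact N) (hNL : N ⊆ Lset lam)
    (hA : Filter.limsup
        (fun k : ℕ => ⨆ s ∈ N, (‖1 / (mu * betaF lam mu (s + (k : ℂ)))‖₊ : ℝ≥0∞)) atTop
      < ENNReal.ofReal (Real.exp lam.re)) :
    ∃ K : ℕ, ∀ k : ℕ, K ≤ k →
      ((∑' j : ℕ, ⨆ s ∈ N,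
          (‖tauP lam mu (j + 1) (s + (k : ℂ)) - tauP lam mu j (s + (k : ℂ))‖₊ : ℝ≥0∞)) ≠ ⊤) ∧
      ∃ T : ℂ → ℂ,
        TendstoUniformlyOn (fun (n : ℕ) (s : ℂ) => tauP lam mu n (s + (k : ℂ))) T atTop N ∧
        DifferentiableOn ℂ T (interior N) := by
  obtain ⟨c, hAc, hc⟩ := exists_between hA
  set a := c.toReal
  have hctop : c ≠ ⊤ := (hc.trans ENNReal.ofReal_lt_top).ne
  have ha0 : 0 ≤ a := ENNReal.toReal_nonneg
  have hbound : ∀ᶠ k : ℕ in atTop, ∀ s ∈ N, ‖1 / (mu * betaF lam mu (s + (k : ℂ)))‖ ≤ a := by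
    filter_upwards [eventually_lt_of_limsup_lt hAc] with k hk s hs
    have h1 := (le_iSup₂ (f := fun s (_ : s ∈ N) =>
      (‖1 / (mu * betaF lam mu (s + (k : ℂ)))‖₊ : ℝ≥0∞)) s hs).trans hk.le
    simpa using ENNReal.toReal_mono hctop h1
  set r := Real.exp (-lam.re) with hr
  have hr0 : 0 < r := Real.exp_pos _
  have hr1 : r < 1 := Real.exp_lt_one_iff.2 (by linarith)
  have har : a * r < 1 := by
    rw [ENNReal.lt_ofReal_iff_toReal_lt hctop] at hc
    rwa [hr, Real.exp_neg, ← div_eq_mul_inv, div_lt_one (Real.exp_pos _)]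
  have har0 : 0 ≤ a * r := by positivity
  obtain ⟨δ, hδ0, hδ1, hq1⟩ : ∃ δ : ℝ, 0 < δ ∧ δ < 1 ∧ a / (1 - δ) * r < 1 := by
    refine ⟨(1 - a * r) / 2, by linarith, by linarith, ?_⟩
    rw [div_mul_eq_mul_div, div_lt_one (by linarith)]
    linarith
  obtain ⟨q, hq⟩ : ∃ q, a / (1 - δ) * r = q := ⟨_, rfl⟩
  rw [hq] at hq1
  have hq0 : 0 ≤ q := by
    have : 0 < 1 - δ := by linarith
    rw [← hq]
    positivity
  obtain ⟨C, hC, hlogC⟩ := exists_norm_log_one_add_exp_le mu hlam hNc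
  have hlim : Tendsto (fun k : ℕ => ‖mu‖ * a * (C / (1 - q) * r ^ k)) atTop (𝓝 0) := by
    simpa using ((tendsto_pow_atTop_nhds_zero_of_lt_one hr0.le hr1).const_mul
      (C / (1 - q))).const_mul (‖mu‖ * a)
  obtain ⟨K, hK⟩ := eventually_atTop.1
    ((hbound.and hlogC).and (hlim.eventually_le_const hδ0))
  have ha : ∀ k, K ≤ k → ∀ s ∈ N, ‖1 / (mu * betaF lam mu (s + (k : ℂ)))‖ ≤ a :=
    fun k hk => (hK k hk).1.1
  have hexp := fun k hk s hs => ((hK k hk).1.2 s hs).1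
  have hlog := fun k hk s hs => ((hK k hk).1.2 s hs).2
  have hsmall := fun k hk => (hK k hk).2
  have hτ := norm_tauP_le hmu hr0 hC hq1 hδ1 hq ha hlog hsmall
  have hdiff := norm_tauP_succ_sub_le hmu hr0 hC hq1 hδ1 hq ha hlog hsmall
  have hsum : ∀ k : ℕ, Summable fun n => C * r ^ k * q ^ n := fun k =>
    (summable_geometric_of_lt_one hq0 hq1).mul_left _
  have hUL : ∀ k : ℕ, ∀ s ∈ interior N, s + k ∈ Lset lam := fun k s hs => by
    have hNs := mem_interior_iff_mem_nhds.1 hs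
    exact add_natCast_mem_Lset hmu hlam (mem_of_superset hNs hNL)
      (fun k hk => mem_of_superset hNs (ha k hk)) k
  refine ⟨K, fun k hk => ⟨ne_top_of_le_ne_top (hsum k).tsum_ofReal_ne_top
    (ENNReal.tsum_le_tsum fun n => iSup₂_le fun s hs => ?_), _,
    tendstoUniformlyOn_of_summable_dist rfl (hsum k) fun n s hs => hdiff n k hk s hs, ?_⟩⟩
  · rw [← enorm_eq_nnnorm, ← ofReal_norm]
    exact ENNReal.ofReal_le_ofReal (hdiff n k hk s hs)
  · refine ((tendstoUniformlyOn_of_summable_dist (F := fun n s => tauP lam mu n (s + k)) rfl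
      (hsum k) fun n s hs => hdiff n k hk s hs).mono
      interior_subset).tendstoLocallyUniformlyOn.differentiableOn
      (Eventually.of_forall fun n => ?_) isOpen_interior
    exact differentiableOn_tauP hmu hlam hδ1 hUL (fun k hk s hs => ha k hk s (interior_subset hs))
      (fun k hk s hs => hexp k hk s (interior_subset hs)) hsmall
      (fun n k hk s hs => hτ n k hk s (interior_subset hs)) n k hk
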